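/- Let p be a prime, k ≥ 1 an integer, and n a positive integer with p ∤ n. Then Φ*_{p^k n}(x) = ∏_{j=0}^{k−1} Φ*_{pn}(x^{p^j}). -/

import Mathlib

open Polynomial Finset

/-- The finset of unitary divisors of `n`: divisors `d` of `n` with `gcd (d, n / d) = 1`. -/
def unitaryDivisors (n : ℕ) : Finset ℕ :=
  n.divisors.filter fun d => Nat.Coprime d (n / d)

/-- `d ∣∣ n`: `d` is a unitary divisor of `n`. -/
def IsUnitaryDivisor (d n : ℕ) : Prop := d ∈ unitaryDivisors n

/-- `(j, n)_*`: the greatest `d` such that `d ∣ j` and `d` is a unitary divisor of `n`. -/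
def unitaryGcd (j n : ℕ) : ℕ :=
  ((unitaryDivisors n).filter fun d => d ∣ j).sup id

/-- `κ(n)`: the squarefree kernel (radical) of `n`. -/
def kernel (n : ℕ) : ℕ := ∏ p ∈ n.primeFactors, p

/-- `φ*(n)`: the unitary Euler totient function. -/
def unitaryTotient (n : ℕ) : ℕ :=
  ((Finset.Icc 1 n).filter fun j => unitaryGcd j n = 1).card

/-- `μ*(n) = (-1)^{ω(n)}`: the unitary Moebius function. -/
def unitaryMoebius (n : ℕ) : ℤ := (-1) ^ n.primeFactors.card

/-- `Φ*_n`: the unitary cyclotomic polynomial (over `ℂ`). -/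
noncomputable def unitaryCyclotomic (n : ℕ) : Polynomial ℂ :=
  ∏ j ∈ (Finset.Icc 1 n).filter fun j => unitaryGcd j n = 1,
    (X - C (Complex.exp (2 * (Real.pi : ℂ) * Complex.I * (j : ℂ) / (n : ℂ))))

/-- `c*_n(k)`: the unitary Ramanujan sum. -/
noncomputable def unitaryRamanujan (n k : ℕ) : ℂ :=
  ∑ j ∈ (Finset.Icc 1 n).filter fun j => unitaryGcd j n = 1,
    Complex.exp (2 * (Real.pi : ℂ) * Complex.I * (j : ℂ) * (k : ℂ) / (n : ℂ))

/-- `c_n(k)`: the classical Ramanujan sum. -/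
noncomputable def ramanujanSum (n k : ℕ) : ℂ :=
  ∑ j ∈ (Finset.Icc 1 n).filter fun j => Nat.Coprime j n,
    Complex.exp (2 * (Real.pi : ℂ) * Complex.I * (j : ℂ) * (k : ℂ) / (n : ℂ))

/-- The unitary convolution `(f × g)(n) = ∑_{d ∣∣ n} f(d) g(n/d)`. -/
noncomputable def unitaryConv (f g : ℕ → ℂ) (n : ℕ) : ℂ :=
  ∑ d ∈ unitaryDivisors n, f d * g (n / d)

/-- `Λ*(n)`: the unitary von Mangoldt function, `a log p` for `n = p^a`, else `0`. -/
noncomputable def unitaryVonMangoldt (n : ℕ) : ℝ :=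
  if IsPrimePow n then (n.factorization n.minFac : ℝ) * Real.log n.minFac else 0

theorem unitaryGcd_eq_one_iff {n : ℕ} (hn : n ≠ 0) (j : ℕ) :
    unitaryGcd j n = 1 ↔ ∀ d, d ∣ n → Nat.Coprime d (n / d) → d ∣ j → d = 1 := by
  unfold unitaryGcd unitaryDivisors
  constructor
  · intro h d hd hc hj
    have hle := Finset.le_sup (f := id) (b := d) (s := {d ∈ n.divisors.filter
      fun d => Nat.Coprime d (n / d) | d ∣ j}) (by simpa [hd, hj, hn] using hc)
    rw [h] at hle
    have := Nat.pos_of_dvd_of_pos hd (Nat.pos_of_ne_zero hn)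
    simp only [id] at hle
    omega
  · intro h
    apply le_antisymm
    · refine Finset.sup_le fun d hd => ?_
      simp only [mem_filter, Nat.mem_divisors] at hd
      exact (h d hd.1.1.1 hd.1.2 hd.2).le
    · exact Finset.le_sup (f := id) (b := 1) (by simp [hn])

theorem unitaryGcd_add_mul_eq_one_iff {n : ℕ} (hn : n ≠ 0) (j t : ℕ) :
    unitaryGcd (j + n * t) n = 1 ↔ unitaryGcd j n = 1 := by
  rw [unitaryGcd_eq_one_iff hn, unitaryGcd_eq_one_iff hn]
  refine forall₃_congr fun d hd _ => ?_
  rw [Nat.dvd_add_left (hd.mul_right t)]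

theorem unitaryGcd_mul_left_eq_one_iff {m n : ℕ} (hn : n ≠ 0) (hmn : Nat.Coprime m n) (j : ℕ) :
    unitaryGcd (m * j) n = 1 ↔ unitaryGcd j n = 1 := by
  rw [unitaryGcd_eq_one_iff hn, unitaryGcd_eq_one_iff hn]
  refine forall₃_congr fun d hd _ => ?_
  rw [(hmn.symm.coprime_dvd_left hd).dvd_mul_left]

theorem unitaryGcd_prime_pow_mul_eq_one_iff {p k n : ℕ} (hp : p.Prime) (hk : k ≠ 0)
    (hn : n ≠ 0) (hpn : ¬ p ∣ n) (j : ℕ) :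
    unitaryGcd j (p ^ k * n) = 1 ↔ unitaryGcd j n = 1 ∧ ¬ p ^ k ∣ j := by
  have hpk : 0 < p ^ k := pow_pos hp.pos k
  have hcop : Nat.Coprime (p ^ k) n := ((Nat.Prime.coprime_iff_not_dvd hp).2 hpn).pow_left k
  rw [unitaryGcd_eq_one_iff (mul_ne_zero hpk.ne' hn), unitaryGcd_eq_one_iff hn]
  constructor
  · intro h
    refine ⟨fun d hd hc hj => h d (hd.mul_left _) ?_ hj, fun hj => ?_⟩
    · rw [Nat.mul_div_assoc _ hd]
      exact (hcop.symm.coprime_dvd_left hd).mul_right hc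
    · have h1 := h (p ^ k) (dvd_mul_right _ _) (by rwa [Nat.mul_div_cancel_left _ hpk]) hj
      exact (Nat.one_lt_pow hk hp.one_lt).ne' h1
  · rintro ⟨h, hpj⟩ d ⟨e, he⟩ hc hj
    have hd0 : 0 < d := Nat.pos_of_ne_zero (by rintro rfl; simp [hn, hp.ne_zero] at he)
    rw [he, Nat.mul_div_cancel_left _ hd0] at hc
    by_cases hpd : p ∣ d
    · have hpe : Nat.Coprime (p ^ k) e := (hc.coprime_dvd_left hpd).pow_left k
      exact absurd ((hpe.dvd_mul_right.1 (he ▸ dvd_mul_right _ _)).trans hj) hpj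
    · have hdp : Nat.Coprime d (p ^ k) :=
        (((Nat.Prime.coprime_iff_not_dvd hp).2 hpd).pow_left k).symm
      have hdn : d ∣ n := hdp.dvd_mul_left.1 ⟨e, he⟩
      refine h d hdn (hc.coprime_dvd_right ?_) hj
      obtain ⟨f, rfl⟩ := hdn
      rw [Nat.mul_div_cancel_left _ hd0]
      exact ⟨p ^ k, Nat.eq_of_mul_eq_mul_left hd0 (by rw [← he]; ring)⟩

theorem prod_range_mul_eq_prod_prod {M : Type*} [CommMonoid M] (f : ℕ → M) (m n : ℕ) :
    ∏ i ∈ range (m * n), f i = ∏ j ∈ range n, ∏ t ∈ range m, f (j + n * t) := by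
  rw [Finset.prod_comm]
  induction m with
  | zero => simp
  | succ m ih =>
    rw [Nat.succ_mul, Finset.prod_range_add, ih, Finset.prod_range_succ]
    simp only [add_comm, mul_comm]

theorem X_pow_sub_C_exp_eq_prod {m n : ℕ} (hm : m ≠ 0) (hn : n ≠ 0) (j : ℕ) :
    (X ^ m - C (Complex.exp (2 * (Real.pi : ℂ) * Complex.I * (j : ℂ) / (n : ℂ))) : ℂ[X]) =
      ∏ t ∈ range m, (X - C (Complex.exp (2 * (Real.pi : ℂ) * Complex.I *
        ((j + n * t : ℕ) : ℂ) / ((m * n : ℕ) : ℂ)))) := by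
  have hm' : (m : ℂ) ≠ 0 := Nat.cast_ne_zero.2 hm
  have hn' : (n : ℂ) ≠ 0 := Nat.cast_ne_zero.2 hn
  have hζ := Complex.isPrimitiveRoot_exp m hm
  rw [X_pow_sub_C_eq_prod hζ (Nat.pos_of_ne_zero hm)
    (α := Complex.exp (2 * (Real.pi : ℂ) * Complex.I * (j : ℂ) / ((m * n : ℕ) : ℂ)))
    (by rw [← Complex.exp_nat_mul]; congr 1; push_cast; field_simp)]
  refine Finset.prod_congr rfl fun t _ => ?_
  rw [← Complex.exp_nat_mul, ← Complex.exp_add]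
  congr 3
  push_cast
  field_simp
  ring

theorem prod_filter_Icc_one_eq_prod_range {M : Type*} [CommMonoid M] (n : ℕ) (P : ℕ → Prop)
    [DecidablePred P] (f : ℕ → M) :
    ∏ j ∈ Icc 1 n with P j, f j = ∏ i ∈ range n, if P (i + 1) then f (i + 1) else 1 := by
  rw [Finset.prod_filter, Finset.range_eq_Ico,
    Finset.prod_Ico_add' (fun j => if P j then f j else 1) 0 n 1]
  rfl

theorem unitaryCyclotomic_comp_X_pow {m n : ℕ} (hm : m ≠ 0) (hn : n ≠ 0) :
    (unitaryCyclotomic n).comp (X ^ m) = ∏ j ∈ Icc 1 (m * n) with unitaryGcd j n = 1,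
      (X - C (Complex.exp (2 * (Real.pi : ℂ) * Complex.I * (j : ℂ) / ((m * n : ℕ) : ℂ)))) := by
  rw [unitaryCyclotomic, Polynomial.prod_comp, prod_filter_Icc_one_eq_prod_range,
    prod_filter_Icc_one_eq_prod_range, prod_range_mul_eq_prod_prod]
  refine Finset.prod_congr rfl fun i _ => ?_
  simp only [add_right_comm i _ 1, unitaryGcd_add_mul_eq_one_iff hn]
  split_ifs
  · rw [sub_comp, X_comp, C_comp, X_pow_sub_C_exp_eq_prod hm hn]
  · simp

theorem unitaryCyclotomic_comp_X_pow_prime_pow {p k n : ℕ} (hp : p.Prime) (hk : k ≠ 0)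
    (hn : n ≠ 0) (hpn : ¬ p ∣ n) :
    (unitaryCyclotomic n).comp (X ^ p ^ k) =
      unitaryCyclotomic (p ^ k * n) * unitaryCyclotomic n := by
  have hpk : 0 < p ^ k := pow_pos hp.pos k
  have hcop : Nat.Coprime (p ^ k) n := ((Nat.Prime.coprime_iff_not_dvd hp).2 hpn).pow_left k
  rw [unitaryCyclotomic_comp_X_pow hpk.ne' hn,
    ← Finset.prod_filter_not_mul_prod_filter _ (fun j => p ^ k ∣ j), Finset.filter_filter,
    Finset.filter_filter]
  congr 1
  · simp only [unitaryCyclotomic, unitaryGcd_prime_pow_mul_eq_one_iff hp hk hn hpn]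
  · symm
    refine Finset.prod_bij (fun j _ => p ^ k * j) (fun j hj => ?_) (fun i _ j _ h => ?_)
      (fun l hl => ?_) (fun j _ => ?_)
    · simp only [mem_filter, mem_Icc] at hj ⊢
      exact ⟨⟨Nat.mul_pos hpk hj.1.1, Nat.mul_le_mul_left _ hj.1.2⟩,
        (unitaryGcd_mul_left_eq_one_iff hn hcop j).2 hj.2, dvd_mul_right _ _⟩
    · exact Nat.eq_of_mul_eq_mul_left hpk h
    · simp only [mem_filter, mem_Icc] at hl
      obtain ⟨⟨h1, h2⟩, h3, j, rfl⟩ := hl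
      refine ⟨j, ?_, rfl⟩
      simp only [mem_filter, mem_Icc]
      exact ⟨⟨Nat.pos_of_mul_pos_left h1, Nat.le_of_mul_le_mul_left h2 hpk⟩,
        (unitaryGcd_mul_left_eq_one_iff hn hcop j).1 h3⟩
    · have hpk' : ((p ^ k : ℕ) : ℂ) ≠ 0 := Nat.cast_ne_zero.2 hpk.ne'
      rw [Nat.cast_mul, Nat.cast_mul, mul_left_comm, mul_div_mul_left _ _ hpk']

theorem unitaryCyclotomic_monic (n : ℕ) : (unitaryCyclotomic n).Monic :=
  monic_prod_of_monic _ _ fun _ _ => monic_X_sub_C _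

theorem prod_unitaryCyclotomic_comp_mul {p n : ℕ} (hp : p.Prime) (hn : n ≠ 0)
    (hpn : ¬ p ∣ n) (k : ℕ) :
    (∏ j ∈ range k, (unitaryCyclotomic (p * n)).comp (X ^ p ^ j)) * unitaryCyclotomic n =
      (unitaryCyclotomic n).comp (X ^ p ^ k) := by
  induction k with
  | zero => simp
  | succ k ih =>
    have h := unitaryCyclotomic_comp_X_pow_prime_pow hp one_ne_zero hn hpn
    rw [pow_one] at h
    rw [prod_range_succ, mul_right_comm, ih, mul_comm, ← mul_comp, ← h, comp_assoc, X_pow_comp,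
      ← pow_mul, ← pow_succ]

/-- for `p` prime, `k ≥ 1`, `p ∤ n`:
`Φ*_{p^k n}(x) = ∏_{j=0}^{k-1} Φ*_{pn}(x^{p^j})`. -/
theorem unitaryCyclotomic_prime_pow_mul_eq_prod (p k n : ℕ) (hp : p.Prime) (hk : 1 ≤ k)
    (hn : 0 < n) (hpn : ¬ p ∣ n) :
    unitaryCyclotomic (p ^ k * n) =
      ∏ j ∈ Finset.range k, (unitaryCyclotomic (p * n)).comp (X ^ p ^ j) := by
  refine mul_right_cancel₀ (unitaryCyclotomic_monic n).ne_zero ?_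
  rw [prod_unitaryCyclotomic_comp_mul hp hn.ne' hpn,
    unitaryCyclotomic_comp_X_pow_prime_pow hp (by omega) hn.ne' hpn]
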